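/- arXiv:1511.08054 — 2 statements merged into one kernel-verified Lean document; each statement's English description precedes it below -/
import Mathlib

section
/- Let G be a 2-connected graph containing a K_4 minor, and let u, v be distinct vertices of G. Then G has a K_4 minor in which u and v are mapped into distinct branch sets. -/
/-- `G` is 2-connected: at least 3 vertices, connected, and still connected
after deleting any single vertex. -/
def IsTwoConnected {V : Type*} [Fintype V] (G : SimpleGraph V) : Prop :=
  3 ≤ Fintype.card V ∧ G.Connected ∧
    ∀ v : V, (G.induce ({v}ᶜ : Set V)).Connected

/-- `G` has a `K_4` minor, given by four disjoint connected branch sets with an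
edge of `G` between any two of them. -/
def HasK4Minor {V : Type*} (G : SimpleGraph V) : Prop :=
  ∃ B : Fin 4 → Set V,
    (∀ i, (G.induce (B i)).Connected) ∧
    (Pairwise fun i j => Disjoint (B i) (B j)) ∧
    (∀ i j, i ≠ j → ∃ x ∈ B i, ∃ y ∈ B j, G.Adj x y)

namespace RootedK4

open SimpleGraph

variable {V : Type*}

/-- The induced subgraph on `S` is connected. -/
def Conn (G : SimpleGraph V) (S : Set V) : Prop := (G.induce S).Connected

theorem Conn.cross {G : SimpleGraph V} {S : Set V} (h : Conn G S) (X : Set V) {a b : V}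
    (ha : a ∈ S) (haX : a ∈ X) (hb : b ∈ S) (hbX : b ∉ X) :
    ∃ x ∈ S, x ∈ X ∧ ∃ y ∈ S, y ∉ X ∧ G.Adj x y := by
  obtain ⟨p⟩ := h.preconnected ⟨a, ha⟩ ⟨b, hb⟩
  obtain ⟨d, _, h1, h2⟩ := p.exists_boundary_dart {z | z.1 ∈ X} haX hbX
  exact ⟨d.fst.1, d.fst.2, h1, d.snd.1, d.snd.2, h2, d.adj⟩

theorem conn_singleton (G : SimpleGraph V) (a : V) : Conn G {a} := by
  unfold Conn
  have : Nonempty ({a} : Set V) := ⟨⟨a, rfl⟩⟩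
  refine ⟨fun x y => ?_⟩
  have : x = y := Subsingleton.elim _ _
  rw [this]

theorem Conn.adj_union {G : SimpleGraph V} {S T : Set V} (hS : Conn G S) (hT : Conn G T)
    {a b : V} (ha : a ∈ S) (hb : b ∈ T) (h : G.Adj a b) : Conn G (S ∪ T) := by
  have h1 := induce_union_connected hS.preconnected
    (induce_pair_connected_of_adj h).preconnected ⟨a, ha, Or.inl rfl⟩
  have h2 := induce_union_connected h1.preconnected hT.preconnected ⟨b, Or.inr (Or.inr rfl), hb⟩
  have e : S ∪ {a, b} ∪ T = S ∪ T := by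
    ext z
    simp only [Set.mem_union, Set.mem_insert_iff, Set.mem_singleton_iff]
    constructor
    · rintro ((h | rfl | rfl) | h) <;> tauto
    · tauto
  rw [e] at h2
  exact h2

theorem Conn.nonempty {G : SimpleGraph V} {S : Set V} (h : Conn G S) : S.Nonempty := by
  obtain ⟨x⟩ := SimpleGraph.Connected.nonempty h
  exact ⟨x.1, x.2⟩

/-- The component of `u` in `S`. -/
def comp (G : SimpleGraph V) (S : Set V) (u : V) : Set V :=
  ⋃₀ {T | T ⊆ S ∧ u ∈ T ∧ Conn G T}

theorem comp_sub (G : SimpleGraph V) (S : Set V) (u : V) : comp G S u ⊆ S :=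
  Set.sUnion_subset fun _ h => h.1

theorem mem_comp {G : SimpleGraph V} {S : Set V} {u : V} (h : u ∈ S) : u ∈ comp G S u :=
  ⟨{u}, ⟨by simpa using h, rfl, conn_singleton G u⟩, rfl⟩

theorem comp_conn {G : SimpleGraph V} {S : Set V} {u : V} (h : u ∈ S) : Conn G (comp G S u) := by
  apply induce_sUnion_connected_of_pairwise_not_disjoint
  · exact ⟨{u}, by simpa using h, rfl, conn_singleton G u⟩
  · intro s t hs ht
    exact ⟨u, hs.2.1, ht.2.1⟩
  · intro s hs
    exact hs.2.2

theorem comp_max {G : SimpleGraph V} {S D : Set V} {u : V} (hD : D ⊆ S) (hu : u ∈ D)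
    (h : Conn G D) : D ⊆ comp G S u :=
  Set.subset_sUnion_of_mem ⟨hD, hu, h⟩

theorem comp_closed {G : SimpleGraph V} {S : Set V} {u x y : V} (hx : x ∈ comp G S u)
    (hy : y ∈ S) (h : G.Adj x y) : y ∈ comp G S u := by
  obtain ⟨T, ⟨h1, h2, h3⟩, hxT⟩ := hx
  exact ⟨T ∪ {y}, ⟨Set.union_subset h1 (by simpa using hy), Or.inl h2,
    h3.adj_union (conn_singleton G y) hxT rfl h⟩, Or.inr rfl⟩

theorem conn_compl_comp {G : SimpleGraph V} {S : Set V} (hS : Conn G S) {s u : V} (hs : s ∈ S) :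
    Conn G (S \ comp G (S \ {s}) u) := by
  have hsC : s ∈ S \ comp G (S \ {s}) u := ⟨hs, fun h => (comp_sub _ _ _ h).2 rfl⟩
  have : S \ comp G (S \ {s}) u = comp G (S \ comp G (S \ {s}) u) s := by
    apply Set.Subset.antisymm _ (comp_sub _ _ _)
    by_contra hn
    obtain ⟨y, hy, hyD⟩ := Set.not_subset.1 hn
    obtain ⟨x, hxS, hxX, z, hzS, hzX, hadj⟩ := hS.cross
      (comp G (S \ {s}) u ∪ comp G (S \ comp G (S \ {s}) u) s) hs (Or.inr (mem_comp hsC)) hy.1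
      (by rintro (h | h); exacts [hy.2 h, hyD h])
    apply hzX
    rcases hxX with h | h
    · refine Or.inl (comp_closed h ⟨hzS, ?_⟩ hadj)
      rintro rfl
      exact hzX (Or.inr (mem_comp hsC))
    · exact Or.inr (comp_closed h ⟨hzS, fun h => hzX (Or.inl h)⟩ hadj)
  rw [this]
  exact comp_conn hsC

theorem partition [Finite V] {G : SimpleGraph V} {A N : Set V} (hA : Conn G A)
    (H : ∀ x ∈ A, ∀ X ⊆ A, X.Nonempty → x ∉ X → (∀ n ∈ X, n ∉ N) →
      ∃ a ∈ X, ∃ b ∈ A, b ∉ X ∧ b ≠ x ∧ G.Adj a b)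
    {u v : V} (hu : u ∈ A) (hv : v ∈ A) (huv : u ≠ v) :
    ∃ T ⊆ A, Conn G T ∧ Conn G (A \ T) ∧ v ∈ T ∧ u ∉ T ∧ (∃ n ∈ T, n ∈ N) ∧
      ∃ n ∈ A \ T, n ∈ N := by
  by_contra hno
  let P : Set V → Prop := fun T => T ⊆ A ∧ Conn G T ∧ Conn G (A \ T) ∧ v ∈ T ∧ u ∉ T ∧
    (∃ n ∈ A \ T, n ∈ N)
  have hP : ∀ T, P T → ∀ n ∈ T, n ∉ N := fun T h n hn hN =>
    hno ⟨T, h.1, h.2.1, h.2.2.1, h.2.2.2.1, h.2.2.2.2.1, ⟨n, hn, hN⟩, h.2.2.2.2.2⟩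
  have hex : ∃ T, P T := by
    have huc : u ∈ comp G (A \ {v}) u := mem_comp ⟨hu, huv⟩
    have hsub : comp G (A \ {v}) u ⊆ A := (comp_sub _ _ _).trans Set.sdiff_subset
    have hvc : v ∉ comp G (A \ {v}) u := fun h => (comp_sub _ _ _ h).2 rfl
    have e : A \ (A \ comp G (A \ {v}) u) = comp G (A \ {v}) u := by
      rw [Set.sdiff_sdiff_right_self, Set.inter_eq_right.2 hsub]
    refine ⟨A \ comp G (A \ {v}) u, Set.sdiff_subset, conn_compl_comp hA hv, ?_, ⟨hv, hvc⟩,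
      fun h => h.2 huc, ?_⟩
    · rw [e]; exact comp_conn ⟨hu, huv⟩
    · rw [e]
      by_contra hc
      push Not at hc
      obtain ⟨a, ha, b, hb, hbX, hbv, hab⟩ := H v hv _ hsub ⟨u, huc⟩ hvc hc
      exact hbX (comp_closed ha ⟨hb, hbv⟩ hab)
  obtain ⟨T, hT⟩ := (Set.toFinite {T | P T}).exists_maximal hex
  obtain ⟨⟨hTA, hTc, hSc, hvT, huT, hSN⟩, hmax⟩ := hT
  have hTN := hP T ⟨hTA, hTc, hSc, hvT, huT, hSN⟩
  have huS : u ∈ A \ T := ⟨hu, huT⟩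
  let Q : Set V := {s | s ∈ A \ T ∧ s ≠ u ∧ ∃ t ∈ T, G.Adj t s}
  have hQ : ∀ s ∈ Q, ∀ n ∈ comp G ((A \ T) \ {s}) u, n ∉ N := by
    rintro s ⟨hsS, hsu, t, ht, hts⟩ n hn hnN
    have hsC : s ∉ comp G ((A \ T) \ {s}) u := fun h => (comp_sub _ _ _ h).2 rfl
    have hsub : comp G ((A \ T) \ {s}) u ⊆ A \ T := (comp_sub _ _ _).trans Set.sdiff_subset
    have huc : u ∈ comp G ((A \ T) \ {s}) u := mem_comp ⟨huS, fun h => hsu h.symm⟩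
    have e : A \ (T ∪ ((A \ T) \ comp G ((A \ T) \ {s}) u)) = comp G ((A \ T) \ {s}) u := by
      ext z
      have := @hsub z
      simp only [Set.mem_sdiff, Set.mem_union] at this ⊢
      tauto
    have hP' : P (T ∪ ((A \ T) \ comp G ((A \ T) \ {s}) u)) := by
      refine ⟨Set.union_subset hTA (Set.sdiff_subset.trans Set.sdiff_subset),
        hTc.adj_union (conn_compl_comp hSc hsS) ht ⟨hsS, hsC⟩ hts, ?_, Or.inl hvT, ?_, ?_⟩
      · rw [e]; exact comp_conn ⟨huS, fun h => hsu h.symm⟩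
      · rintro (h | h)
        exacts [huT h, h.2 huc]
      · rw [e]; exact ⟨n, hn, hnN⟩
    have := hmax hP' Set.subset_union_left (Or.inr ⟨hsS, hsC⟩ : s ∈ _)
    exact hsS.2 this
  have hQne : Q.Nonempty := by
    obtain ⟨a, ha, b, hb, hbX, hbv, hab⟩ := H u hu T hTA ⟨v, hvT⟩ huT hTN
    exact ⟨b, ⟨hb, hbX⟩, hbv, a, ha, hab⟩
  obtain ⟨s, hsQ, hsmax⟩ := (Set.toFinite Q).exists_maximalFor
    (fun s => comp G ((A \ T) \ {s}) u) Q hQne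
  have hC := hQ s hsQ
  have hsC : s ∉ comp G ((A \ T) \ {s}) u := fun h => (comp_sub _ _ _ h).2 rfl
  have hsub : comp G ((A \ T) \ {s}) u ⊆ A \ T := (comp_sub _ _ _).trans Set.sdiff_subset
  have huc : u ∈ comp G ((A \ T) \ {s}) u := mem_comp ⟨huS, fun h => hsQ.2.1 h.symm⟩
  have hCc : Conn G (comp G ((A \ T) \ {s}) u) := comp_conn ⟨huS, fun h => hsQ.2.1 h.symm⟩
  obtain ⟨a, ha, b, hb, hbX, hbs, hab⟩ := H s hsQ.1.1 (comp G ((A \ T) \ {s}) u ∪ T)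
    (Set.union_subset (hsub.trans Set.sdiff_subset) hTA) ⟨u, Or.inl huc⟩
    (by rintro (h | h); exacts [hsC h, hsQ.1.2 h])
    (by rintro n (h | h); exacts [hC n h, hTN n h])
  have hbC : b ∉ comp G ((A \ T) \ {s}) u := fun h => hbX (Or.inl h)
  have hbS : b ∈ A \ T := ⟨hb, fun h => hbX (Or.inr h)⟩
  rcases ha with ha | ha
  · exact hbC (comp_closed ha ⟨hbS, hbs⟩ hab)
  have hbQ : b ∈ Q := ⟨hbS, fun h => hbC (h ▸ huc), a, ha, hab⟩
  have hsubset : comp G ((A \ T) \ {s}) u ⊆ comp G ((A \ T) \ {b}) u := by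
    refine comp_max (fun z hz => ⟨hsub hz, ?_⟩) huc hCc
    rintro rfl
    exact hbC hz
  have hback := hsmax hbQ hsubset
  -- `s` is adjacent to the component
  obtain ⟨x, hxS, hx, y, hyS, hy, hxy⟩ := hSc.cross (comp G ((A \ T) \ {s}) u) huS huc hsQ.1 hsC
  have hys : y = s := by
    by_contra hne
    exact hy (comp_closed hx ⟨hyS, hne⟩ hxy)
  subst hys
  exact hsC (hback (comp_closed (hsubset hx) ⟨hyS, fun h => hbs h.symm⟩ hxy))

/-- `B` is a `K_4` model. -/
def Model (G : SimpleGraph V) (B : Fin 4 → Set V) : Prop :=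
    (∀ i, Conn G (B i)) ∧
    (Pairwise fun i j => Disjoint (B i) (B j)) ∧
    (∀ i j, i ≠ j → ∃ x ∈ B i, ∃ y ∈ B j, G.Adj x y)

theorem exists_cover [Finite V] {G : SimpleGraph V} (hG : G.Connected)
    (h : ∃ B, Model G B) : ∃ B, Model G B ∧ ∀ x, ∃ i, x ∈ B i := by
  obtain ⟨B, hB, hmax⟩ := (Set.toFinite {B | Model G B}).exists_maximal h
  refine ⟨B, hB, ?_⟩
  by_contra hc
  push Not at hc
  obtain ⟨z, hz⟩ := hc
  obtain ⟨hB1, hB2, hB3⟩ := hB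
  obtain ⟨a, ha⟩ := (hB1 0).nonempty
  obtain ⟨p⟩ := hG.preconnected a z
  obtain ⟨d, _, h1, h2⟩ := p.exists_boundary_dart {x | ∃ i, x ∈ B i} ⟨0, ha⟩
    (by rintro ⟨i, hi⟩; exact hz i hi)
  obtain ⟨i, hi⟩ := h1
  have h2' : ∀ j, d.snd ∉ B j := fun j hj => h2 ⟨j, hj⟩
  have hle : B ≤ Function.update B i (B i ∪ {d.snd}) := by
    intro j
    by_cases hj : j = i
    · subst hj; simp
    · simp [hj]
  have hM : Model G (Function.update B i (B i ∪ {d.snd})) := by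
    refine ⟨fun j => ?_, fun j k hjk => ?_, fun j k hjk => ?_⟩
    · by_cases hj : j = i
      · subst hj
        simpa using (hB1 j).adj_union (conn_singleton G d.snd) hi rfl d.adj
      · simpa [hj] using hB1 j
    · have := hB2 hjk
      by_cases hj : j = i
      · subst hj
        simp only [Function.update_self, Function.update_of_ne hjk.symm]
        simpa [h2'] using this
      · by_cases hk : k = i
        · subst hk
          simp only [Function.update_self, Function.update_of_ne hj]
          simpa [h2'] using this
        · simpa [hj, hk] using this
    · obtain ⟨x, hx, y, hy, hxy⟩ := hB3 j k hjk
      exact ⟨x, hle j hx, y, hle k hy, hxy⟩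
  have := hmax hM hle i
  rw [Function.update_self] at this
  exact h2' i (this (Or.inr rfl))

theorem split {G : SimpleGraph V} {B : Fin 4 → Set V} (hB : Model G B) {i k : Fin 4}
    (hik : k ≠ i) {P Q : Set V} (hP : Conn G P) (hQ : Conn G Q) (hPB : P ⊆ B i) (hQB : Q ⊆ B i)
    (hd : Disjoint P Q) (hPQ : ∃ x ∈ P, ∃ y ∈ Q, G.Adj x y)
    (hQk : ∃ x ∈ Q, ∃ y ∈ B k, G.Adj x y)
    (hPl : ∀ l, l ≠ i → l ≠ k → ∃ x ∈ P, ∃ y ∈ B l, G.Adj x y) :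
    ∃ B', Model G B' ∧ P ⊆ B' i ∧ Q ⊆ B' k := by
  obtain ⟨hB1, hB2, hB3⟩ := hB
  let B' : Fin 4 → Set V := fun j => if j = i then P else if j = k then Q ∪ B k else B j
  have ei : B' i = P := by simp [B']
  have ek : B' k = Q ∪ B k := by simp [B', hik]
  have eo : ∀ j, j ≠ i → j ≠ k → B' j = B j := fun j h1 h2 => by simp [B', h1, h2]
  have hsub : ∀ j, j ≠ i → B j ⊆ B' j := by
    intro j hj
    by_cases hjk : j = k
    · subst hjk; rw [ek]; exact Set.subset_union_right
    · rw [eo j hj hjk]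
  refine ⟨B', ⟨fun j => ?_, ?_, ?_⟩, ei.ge, ek.ge.trans' Set.subset_union_left⟩
  · by_cases hj : j = i
    · subst hj; rw [ei]; exact hP
    · by_cases hjk : j = k
      · subst hjk; rw [ek]
        obtain ⟨x, hx, y, hy, hxy⟩ := hQk
        exact hQ.adj_union (hB1 _) hx hy hxy
      · rw [eo j hj hjk]; exact hB1 j
  · have hdi : ∀ j, j ≠ i → Disjoint (B' i) (B' j) := by
      intro j hj
      rw [ei]
      by_cases hjk : j = k
      · subst hjk; rw [ek]
        exact Set.disjoint_union_right.2 ⟨hd, (hB2 hj.symm).mono_left hPB⟩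
      · rw [eo j hj hjk]; exact (hB2 hj.symm).mono_left hPB
    have hdk : ∀ j, j ≠ i → j ≠ k → Disjoint (B' k) (B' j) := by
      intro j hj hjk
      rw [ek, eo j hj hjk]
      exact Set.disjoint_union_left.2 ⟨(hB2 hj.symm).mono_left hQB, hB2 hjk.symm⟩
    intro j l hjl
    by_cases hj : j = i
    · subst hj; exact hdi l hjl.symm
    by_cases hl : l = i
    · subst hl; exact (hdi j hjl).symm
    by_cases hjk : j = k
    · subst hjk; exact hdk l hl hjl.symm
    by_cases hlk : l = k
    · subst hlk; exact (hdk j hj hjl).symm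
    rw [eo j hj hjk, eo l hl hlk]
    exact hB2 hjl
  · have hai : ∀ j, j ≠ i → ∃ x ∈ B' i, ∃ y ∈ B' j, G.Adj x y := by
      intro j hj
      by_cases hjk : j = k
      · subst hjk
        obtain ⟨x, hx, y, hy, hxy⟩ := hPQ
        exact ⟨x, ei.ge hx, y, ek.ge (Or.inl hy), hxy⟩
      · obtain ⟨x, hx, y, hy, hxy⟩ := hPl j hj hjk
        exact ⟨x, ei.ge hx, y, hsub j hj hy, hxy⟩
    intro j l hjl
    by_cases hj : j = i
    · subst hj; exact hai l hjl.symm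
    by_cases hl : l = i
    · subst hl
      obtain ⟨x, hx, y, hy, hxy⟩ := hai j hjl
      exact ⟨y, hy, x, hx, hxy.symm⟩
    obtain ⟨x, hx, y, hy, hxy⟩ := hB3 j l hjl
    exact ⟨x, hsub j hj hx, y, hsub l hl hy, hxy⟩

theorem choose_index (i : Fin 4) (f g : Fin 4 → Prop) (hfg : ∀ l, l ≠ i → f l ∨ g l)
    (hf : ∃ l, l ≠ i ∧ f l) (hg : ∃ l, l ≠ i ∧ g l) :
    ∃ k, k ≠ i ∧ ((g k ∧ ∀ l, l ≠ i → l ≠ k → f l) ∨ (f k ∧ ∀ l, l ≠ i → l ≠ k → g l)) := by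
  by_cases hall : ∀ l, l ≠ i → f l
  · obtain ⟨k, hk, hgk⟩ := hg
    exact ⟨k, hk, Or.inl ⟨hgk, fun l hl _ => hall l hl⟩⟩
  push Not at hall
  obtain ⟨k, hk, hfk⟩ := hall
  have hgk := (hfg k hk).resolve_left hfk
  by_cases hall : ∀ l, l ≠ i → l ≠ k → f l
  · exact ⟨k, hk, Or.inl ⟨hgk, hall⟩⟩
  push Not at hall
  obtain ⟨l, hl, hlk, hfl⟩ := hall
  have hgl := (hfg l hl).resolve_left hfl
  obtain ⟨m, hm, hfm⟩ := hf
  have hmk : m ≠ k := fun h => hfk (h ▸ hfm)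
  have hml : m ≠ l := fun h => hfl (h ▸ hfm)
  refine ⟨m, hm, Or.inr ⟨hfm, fun q hqi hqm => ?_⟩⟩
  have : q = k ∨ q = l := by omega
  rcases this with rfl | rfl
  exacts [hgk, hgl]

end RootedK4

open RootedK4 in
/-- In a 2-connected graph with a `K_4` minor, for any two distinct vertices
`u, v` there is a `K_4` minor with `u` and `v` in distinct branch sets. -/
theorem rooted_K4_minor
    {V : Type*} [Fintype V] (G : SimpleGraph V)
    (h2 : IsTwoConnected G) (hK4 : HasK4Minor G)
    (u v : V) (huv : u ≠ v) :
    ∃ B : Fin 4 → Set V,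
      (∀ i, (G.induce (B i)).Connected) ∧
      (Pairwise fun i j => Disjoint (B i) (B j)) ∧
      (∀ i j, i ≠ j → ∃ x ∈ B i, ∃ y ∈ B j, G.Adj x y) ∧
      (∃ i j, i ≠ j ∧ u ∈ B i ∧ v ∈ B j) := by
  obtain ⟨_, hconn, hdel⟩ := h2
  obtain ⟨B, hB, hcov⟩ := exists_cover hconn hK4
  suffices h : ∃ B, Model G B ∧ ∃ i j, i ≠ j ∧ u ∈ B i ∧ v ∈ B j by
    obtain ⟨B, ⟨h1, h2, h3⟩, h4⟩ := h
    exact ⟨B, h1, h2, h3, h4⟩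
  obtain ⟨i, hi⟩ := hcov u
  obtain ⟨j, hj⟩ := hcov v
  by_cases hij : i = j
  swap
  · exact ⟨B, hB, i, j, hij, hi, hj⟩
  subst hij
  obtain ⟨o, hoi⟩ : ∃ o : Fin 4, o ≠ i := exists_ne i
  obtain ⟨w, hw⟩ := (hB.1 o).nonempty
  have hwi : w ∉ B i := fun h => Set.disjoint_left.1 (hB.2.1 hoi) hw h
  obtain ⟨T, hTA, hTc, hSc, hvT, huT, ⟨n, hnT, l, hl, b, hb, hnb⟩,
      ⟨n', hnS, l', hl', b', hb', hnb'⟩⟩ :=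
    partition (N := {x | ∃ l, l ≠ i ∧ ∃ y ∈ B l, G.Adj x y}) (hB.1 i) (by
      intro x hx X hX ⟨a, ha⟩ hxX hXN
      have hax : a ≠ x := fun h => hxX (h ▸ ha)
      have hwx : w ≠ x := fun h => hwi (h ▸ hx)
      obtain ⟨c, hc, hcX, d, hd, hdX, hcd⟩ := Conn.cross (hdel x) X (a := a) (b := w)
        hax ha hwx (fun h => hwi (hX h))
      refine ⟨c, hcX, d, ?_, hdX, hd, hcd⟩
      obtain ⟨m, hm⟩ := hcov d
      by_cases hmi : m = i
      · exact hmi ▸ hm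
      · exact absurd ⟨m, hmi, d, hm, hcd⟩ (hXN c hcX)) hi hj huv
  obtain ⟨x, hx, hxT, y, hy, hyT, hxy⟩ := (hB.1 i).cross T hj hvT hi huT
  obtain ⟨k, hk, h | h⟩ := choose_index i (fun l => ∃ x ∈ T, ∃ y ∈ B l, G.Adj x y)
    (fun l => ∃ x ∈ B i \ T, ∃ y ∈ B l, G.Adj x y)
    (by
      intro l hl
      obtain ⟨x, hx, y, hy, hxy⟩ := hB.2.2 i l hl.symm
      by_cases hxT : x ∈ T
      · exact Or.inl ⟨x, hxT, y, hy, hxy⟩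
      · exact Or.inr ⟨x, ⟨hx, hxT⟩, y, hy, hxy⟩)
    ⟨l, hl, n, hnT, b, hb, hnb⟩ ⟨l', hl', n', hnS, b', hb', hnb'⟩
  · obtain ⟨B', hM, h1, h2⟩ := split hB hk hTc hSc hTA Set.sdiff_subset Set.disjoint_sdiff_right
      ⟨x, hxT, y, ⟨hy, hyT⟩, hxy⟩ h.1 h.2
    exact ⟨B', hM, k, i, hk, h2 ⟨hi, huT⟩, h1 hvT⟩
  · obtain ⟨B', hM, h1, h2⟩ := split hB hk hSc hTc Set.sdiff_subset hTA Set.disjoint_sdiff_left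
      ⟨y, ⟨hy, hyT⟩, x, hxT, hxy.symm⟩ h.1 h.2
    exact ⟨B', hM, i, k, hk.symm, h1 ⟨hi, huT⟩, h2 hvT⟩
end

section
/- The only 3-connected graph with no W_4 minor is K_4. That is, if G is a 3-connected simple graph that does not contain the 5-vertex wheel W_4 as a minor, then G is isomorphic to K_4. -/
/-- The wheel `W_4` on 5 vertices: the 4-cycle `0-1-2-3` plus the hub `4`. -/
def W4 : SimpleGraph (Fin 5) :=
  SimpleGraph.fromEdgeSet
    {s(0, 1), s(1, 2), s(2, 3), s(3, 0), s(0, 4), s(1, 4), s(2, 4), s(3, 4)}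

/-- `G` is 3-connected: at least 4 vertices, and deleting any set of at most 2
vertices leaves a connected graph. -/
def IsThreeConnected {V : Type*} [Fintype V] [DecidableEq V]
    (G : SimpleGraph V) : Prop :=
  4 ≤ Fintype.card V ∧
    ∀ s : Finset V, s.card ≤ 2 → (G.induce ((↑s : Set V)ᶜ)).Connected

/-- `G` has a `W_4` minor: disjoint connected branch sets indexed by the
vertices of `W_4`, with an edge of `G` between branch sets corresponding to
adjacent vertices of `W_4`. -/
def HasW4Minor {V : Type*} (G : SimpleGraph V) : Prop :=
  ∃ B : Fin 5 → Set V,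
    (∀ i, (G.induce (B i)).Connected) ∧
    (Pairwise fun i j => Disjoint (B i) (B j)) ∧
    (∀ i j, W4.Adj i j → ∃ x ∈ B i, ∃ y ∈ B j, G.Adj x y)

/-- 3-connectivity in cut form. -/
def Cut3 {V : Type*} (G : SimpleGraph V) : Prop :=
  ∀ (C : Set V) (a b : V), C.Nonempty → a ∉ C → b ∉ C →
    (∀ u ∈ C, ∀ w, G.Adj u w → w ∈ C ∨ w = a ∨ w = b) → ∀ w, w ∈ C ∨ w = a ∨ w = b

/-- Image of a graph under a map of vertices (loops removed). -/
def quot {V W : Type*} (G : SimpleGraph V) (f : V → W) : SimpleGraph W where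
  Adj a b := a ≠ b ∧ ∃ u w, f u = a ∧ f w = b ∧ G.Adj u w
  symm := ⟨fun _ _ ⟨h, u, w, hu, hw, huw⟩ => ⟨h.symm, w, u, hw, hu, huw.symm⟩⟩
  loopless := ⟨fun _ h => h.1 rfl⟩

/-- `C` is a fragment separated by `x, y, z`. -/
def Frag {V : Type*} (G : SimpleGraph V) (x y z : V) (C : Set V) : Prop :=
  C.Nonempty ∧ x ∉ C ∧ y ∉ C ∧ z ∉ C ∧
    (∀ u ∈ C, ∀ w, G.Adj u w → w ∈ C ∨ w = x ∨ w = y ∨ w = z) ∧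
    ∃ w, w ∉ C ∧ w ≠ x ∧ w ≠ y ∧ w ≠ z

theorem cut3_of {V : Type*} [Fintype V] [DecidableEq V] (G : SimpleGraph V)
    (h3 : IsThreeConnected G) : Cut3 G := by
  intro C a b ⟨u, hu⟩ ha hb hC w
  by_contra hw
  push Not at hw
  have hc := h3.2 {a, b} Finset.card_le_two
  have hu' : u ∈ (↑({a, b} : Finset V) : Set V)ᶜ := by
    simp; constructor <;> rintro rfl <;> contradiction
  have hw' : w ∈ (↑({a, b} : Finset V) : Set V)ᶜ := by
    simp; exact ⟨hw.2.1, hw.2.2⟩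
  obtain ⟨p⟩ := hc.preconnected ⟨u, hu'⟩ ⟨w, hw'⟩
  have key : ∀ (s t : ((↑({a, b} : Finset V) : Set V)ᶜ : Set V)),
      (G.induce _).Walk s t → s.1 ∈ C → t.1 ∈ C := by
    intro s t p
    induction p with
    | nil => exact id
    | @cons s t r h p ih =>
      intro hs
      apply ih
      have h1 := hC _ hs t.1 h
      have h2 := t.2
      simp at h2
      tauto
  exact hw.1 (key _ _ p hu)

theorem minor_of_quot {V W : Type*} (G : SimpleGraph V) (f : V → W)
    (hs : Function.Surjective f) (hf : ∀ u v, f u = f v → u = v ∨ G.Adj u v)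
    (h : HasW4Minor (quot G f)) : HasW4Minor G := by
  obtain ⟨B, hB, hd, ha⟩ := h
  refine ⟨fun i => f ⁻¹' (B i), ?_, ?_, ?_⟩
  · intro i
    have fib : ∀ (u v : f ⁻¹' (B i)), f u = f v → (G.induce (f ⁻¹' (B i))).Reachable u v := by
      intro u v huv
      rcases hf _ _ huv with h | h
      · rw [Subtype.ext h]
      · exact SimpleGraph.Adj.reachable (by simpa using h)
    have key : ∀ (s t : B i), ((quot G f).induce (B i)).Walk s t →
        ∀ (u v : f ⁻¹' (B i)), f u = s → f v = t → (G.induce (f ⁻¹' (B i))).Reachable u v := by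
      intro s t p
      induction p with
      | nil => intro u v hu hv; exact fib _ _ (hu.trans hv.symm)
      | @cons s t r h p ih =>
        intro u v hu hv
        obtain ⟨_, u', w', hu', hw', hadj⟩ := h
        have hu'' : u' ∈ f ⁻¹' (B i) := by
          change f u' ∈ B i
          rw [hu']; exact s.2
        have hw'' : w' ∈ f ⁻¹' (B i) := by
          change f w' ∈ B i
          rw [hw']; exact t.2
        have h1 := fib u ⟨u', hu''⟩ (hu.trans hu'.symm)
        have h2 : (G.induce (f ⁻¹' (B i))).Reachable ⟨u', hu''⟩ ⟨w', hw''⟩ :=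
          SimpleGraph.Adj.reachable (by simpa using hadj)
        exact (h1.trans h2).trans (ih ⟨w', hw''⟩ v hw' hv)
    have hne := (hB i).nonempty
    obtain ⟨b⟩ := hne
    obtain ⟨v, hv⟩ := hs b
    have : Nonempty (f ⁻¹' (B i)) := ⟨⟨v, by change f v ∈ B i; rw [hv]; exact b.2⟩⟩
    refine SimpleGraph.Connected.mk ?_
    intro u v
    obtain ⟨p⟩ := (hB i).preconnected ⟨f u, u.2⟩ ⟨f v, v.2⟩
    exact key _ _ p u v rfl rfl
  · intro i j hij
    exact (hd hij).preimage f
  · intro i j hij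
    obtain ⟨x, hx, y, hy, _, u, w, rfl, rfl, huw⟩ := ha i j hij
    exact ⟨u, hx, w, hy, huw⟩

theorem minor_of_fun {V : Type*} (G : SimpleGraph V) (f : Fin 5 → V)
    (hi : Function.Injective f) (h : ∀ i j, W4.Adj i j → G.Adj (f i) (f j)) :
    HasW4Minor G := by
  refine ⟨fun i => {f i}, ?_, ?_, ?_⟩
  · intro i
    have : Nonempty ({f i} : Set V) := ⟨⟨f i, rfl⟩⟩
    refine SimpleGraph.Connected.mk ?_
    intro u v
    have : u = v := Subsingleton.elim _ _
    rw [this]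
  · intro i j hij
    simpa using fun h => hij (hi h)
  · intro i j hij
    exact ⟨_, rfl, _, rfl, h i j hij⟩

theorem minor_of_five {V : Type*} (G : SimpleGraph V) (a b c d e : V)
    (hi : [a, b, c, d, e].Nodup) (h1 : G.Adj a b) (h2 : G.Adj b c) (h3 : G.Adj c d)
    (h4 : G.Adj d a) (h5 : G.Adj a e) (h6 : G.Adj b e) (h7 : G.Adj c e) (h8 : G.Adj d e) :
    HasW4Minor G := by
  refine minor_of_fun G ![a, b, c, d, e] ?_ ?_
  · intro i j hij
    simp at hi
    fin_cases i <;> fin_cases j <;> simp at hij ⊢ <;> grind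
  · intro i j hij
    fin_cases i <;> fin_cases j <;> simp [W4] at hij ⊢ <;> first | assumption | (symm; assumption)

theorem matching_of_cut3 {V : Type*} [Fintype V] [DecidableEq V] (G : SimpleGraph V)
    (hK : Cut3 G) (h5 : Fintype.card V = 5) (v a b : V) (ha : v ≠ a) (hb : v ≠ b)
    (hva : ¬ G.Adj v a) (hvb : ¬ G.Adj v b) : a = b := by
  by_contra hab
  have hc : (({v, a, b} : Finset V)ᶜ).card = 2 := by
    rw [Finset.card_compl, h5, Finset.card_eq_three.2 ⟨v, a, b, ha, hb, hab, rfl⟩]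
  obtain ⟨c, d, hcd, he⟩ := Finset.card_eq_two.1 hc
  have hm : ∀ w, w ∈ (({v, a, b} : Finset V)ᶜ) ↔ w ∈ ({c, d} : Finset V) := by
    intro w; rw [he]
  simp at hm
  have hmc := hm c
  have hmd := hm d
  have hma := hm a
  simp at hmc hmd hma
  have := hK {v} c d ⟨v, rfl⟩ (fun h => hmc.1 h) (fun h => hmd.1 h) (by
    intro u hu w huw
    have : u = v := hu
    subst this
    have := huw.ne
    have := hm w
    grind) a
  simp at this
  grind

theorem base5 {V : Type*} [Fintype V] [DecidableEq V] (G : SimpleGraph V)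
    (hK : Cut3 G) (h5 : Fintype.card V = 5) : HasW4Minor G := by
  have M := matching_of_cut3 G hK h5
  by_cases hne : ∃ p q, p ≠ q ∧ ¬ G.Adj p q
  · obtain ⟨p, q, hpq, hn⟩ := hne
    have hn' : ¬ G.Adj q p := fun h => hn h.symm
    have hc : (({p, q} : Finset V)ᶜ).card = 3 := by
      rw [Finset.card_compl, h5, Finset.card_pair hpq]
    have main : ∃ r s t, [p, q, r, s, t].Nodup ∧ G.Adj r t ∧ G.Adj s t := by
      obtain ⟨r, s, t, hrs, hrt, hst, he⟩ := Finset.card_eq_three.1 hc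
      have hm : ∀ w, w ∈ (({p, q} : Finset V)ᶜ) ↔ w ∈ ({r, s, t} : Finset V) := by
        intro w; rw [he]
      simp at hm
      have hr := hm r
      have hs := hm s
      have ht := hm t
      simp at hr hs ht
      by_cases h1 : G.Adj r t
      · by_cases h2 : G.Adj s t
        · exact ⟨r, s, t, by simp; grind, h1, h2⟩
        · refine ⟨s, t, r, by simp; grind, ?_, h1.symm⟩
          by_contra h3
          have := M s t r hst hrs.symm h2 h3
          grind
      · refine ⟨r, t, s, by simp; grind, ?_, ?_⟩
        · by_contra h3
          have := M r t s hrt hrs h1 h3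
          grind
        · by_contra h3
          have := M t r s hrt.symm hst.symm (fun h => h1 h.symm) h3
          grind
    obtain ⟨r, s, t, hnd, hrt, hst⟩ := main
    have P : ∀ w, w ≠ p → w ≠ q → G.Adj p w := by
      intro w hw hw'
      by_contra h
      exact hw' (M p w q hw.symm hpq h hn)
    have Q : ∀ w, w ≠ p → w ≠ q → G.Adj q w := by
      intro w hw hw'
      by_contra h
      exact hw (M q w p hw'.symm hpq.symm h hn')
    simp at hnd
    refine minor_of_five G p r q s t (by simp; grind) (P _ ?_ ?_) (Q _ ?_ ?_).symm (Q _ ?_ ?_)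
      (P _ ?_ ?_).symm (P _ ?_ ?_) hrt (Q _ ?_ ?_) hst <;> grind
  · push Not at hne
    let e := (Fintype.equivFinOfCardEq h5).symm
    refine minor_of_fun G e e.injective ?_
    intro i j hij
    exact hne _ _ (fun h => hij.ne (e.injective h))

/-- Contraction map identifying `y` with `x`. -/
def cmap {V : Type*} [DecidableEq V] (x y : V) (hxy : x ≠ y) (v : V) : {v : V // v ≠ y} :=
  if h : v = y then ⟨x, hxy⟩ else ⟨v, h⟩

theorem cmap_eq {V : Type*} [DecidableEq V] (x y : V) (hxy : x ≠ y) (v : V) (w : {v : V // v ≠ y}) :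
    cmap x y hxy v = w ↔ v = w.1 ∨ (v = y ∧ w.1 = x) := by
  unfold cmap
  have := w.2
  split_ifs with h <;> rw [Subtype.ext_iff] <;> simp <;> grind

theorem frag_of {V : Type*} [DecidableEq V] (G : SimpleGraph V) (hK : Cut3 G)
    (x y : V) (hxy : x ≠ y) (hn : ¬ Cut3 (quot G (cmap x y hxy))) :
    ∃ z C, Frag G x y z C := by
  unfold Cut3 at hn
  push Not at hn
  obtain ⟨C, a, b, hne, ha, hb, hC, w, hw, hwa, hwb⟩ := hn
  have hmem : ∀ v : V, ∀ h : v ≠ y, cmap x y hxy v = ⟨v, h⟩ := by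
    intro v h; rw [cmap_eq]; simp
  have hmemy : cmap x y hxy y = ⟨x, hxy⟩ := by rw [cmap_eq]; simp
  obtain ⟨c, hc⟩ := hne
  have hcl : ∀ u w, cmap x y hxy u ∈ C → G.Adj u w →
      cmap x y hxy w ∈ C ∨ (w = a.1 ∨ (w = y ∧ a.1 = x)) ∨ (w = b.1 ∨ (w = y ∧ b.1 = x)) := by
    intro u w hu huw
    by_cases h : cmap x y hxy u = cmap x y hxy w
    · left; rwa [← h]
    · have := hC _ hu (cmap x y hxy w) ⟨h, u, w, rfl, rfl, huw⟩
      rwa [cmap_eq, cmap_eq] at this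
  have hA : cmap x y hxy a.1 ∉ C := by rwa [hmem a.1 a.2]
  have hB : cmap x y hxy b.1 ∉ C := by rwa [hmem b.1 b.2]
  have hW : cmap x y hxy w.1 ∉ C := by rwa [hmem w.1 w.2]
  have hCc : cmap x y hxy c.1 ∈ C := by rwa [hmem c.1 c.2]
  have hxx : cmap x y hxy x = cmap x y hxy y := by rw [hmemy, hmem x hxy]
  have hwa' : w.1 ≠ a.1 := fun h => hwa (Subtype.ext h)
  have hwb' : w.1 ≠ b.1 := fun h => hwb (Subtype.ext h)
  have hwy := w.2
  by_cases hax : a.1 = x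
  · have hxC : cmap x y hxy x ∉ C := fun h => hA ((congrArg (fun t => cmap x y hxy t ∈ C) hax).mpr h)
    refine ⟨b.1, cmap x y hxy ⁻¹' C, ⟨c.1, hCc⟩, hxC, ?_, hB, ?_, w.1, hW, ?_⟩
    · change cmap x y hxy y ∉ C
      rw [← hxx]; exact hxC
    · intro u hu w huw
      have := hcl u w hu huw
      change cmap x y hxy w ∈ C ∨ _
      grind
    · grind
  by_cases hbx : b.1 = x
  · have hxC : cmap x y hxy x ∉ C := fun h => hB ((congrArg (fun t => cmap x y hxy t ∈ C) hbx).mpr h)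
    refine ⟨a.1, cmap x y hxy ⁻¹' C, ⟨c.1, hCc⟩, hxC, ?_, hA, ?_, w.1, hW, ?_⟩
    · change cmap x y hxy y ∉ C
      rw [← hxx]; exact hxC
    · intro u hu w huw
      have := hcl u w hu huw
      change cmap x y hxy w ∈ C ∨ _
      grind
    · grind
  exfalso
  have := hK (cmap x y hxy ⁻¹' C) a.1 b.1 ⟨c.1, hCc⟩ hA hB (by
    intro u hu w huw
    have := hcl u w hu huw
    change cmap x y hxy w ∈ C ∨ _
    grind) w.1
  rcases this with h | h | h
  · exact hW h
  · exact hwa' h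
  · exact hwb' h

theorem frag_step {V : Type*} (G : SimpleGraph V) (hK : Cut3 G)
    (hall : ∀ x y, G.Adj x y → ∃ z C, Frag G x y z C)
    (x y z : V) (C : Set V) (hxy : G.Adj x y) (hF : Frag G x y z C) :
    ∃ x' y' z' C', G.Adj x' y' ∧ Frag G x' y' z' C' ∧ C' ⊂ C := by
  obtain ⟨hne, hx, hy, hz, hcl, w0, hw0, hw0x, hw0y, hw0z⟩ := hF
  -- z has a neighbour v in C
  obtain ⟨v, hv, hzv⟩ : ∃ v ∈ C, G.Adj z v := by
    by_contra h
    push Not at h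
    have := hK C x y hne hx hy (by
      intro u hu w huw
      rcases hcl u hu w huw with h' | h' | h' | h'
      · exact Or.inl h'
      · exact Or.inr (Or.inl h')
      · exact Or.inr (Or.inr h')
      · subst h'; exact absurd huw.symm (h u hu)) w0
    tauto
  obtain ⟨w, D0, hD0⟩ := hall z v hzv
  obtain ⟨D, hD, hxD, hyD⟩ : ∃ D, Frag G z v w D ∧ x ∉ D ∧ y ∉ D := by
    by_cases h : x ∉ D0 ∧ y ∉ D0
    · exact ⟨D0, hD0, h⟩
    · obtain ⟨⟨d, hd⟩, hz0, hv0, hw0, hcl0, e, he, hez, hev, hew⟩ := hD0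
      refine ⟨{u | u ∉ D0 ∧ u ≠ z ∧ u ≠ v ∧ u ≠ w}, ⟨⟨e, he, hez, hev, hew⟩, ?_, ?_, ?_, ?_, d, ?_⟩,
        ?_, ?_⟩
      · simp
      · simp
      · simp
      · rintro u ⟨hu, hu'⟩ t hut
        simp only [Set.mem_ofPred_eq]
        by_cases ht : t ∈ D0
        · have := hcl0 t ht u hut.symm
          tauto
        · tauto
      · refine ⟨fun h => h.1 hd, ?_, ?_, ?_⟩ <;> rintro rfl <;> contradiction
      · rintro ⟨h1, h2⟩
        have hyy : y ∈ D0 := by tauto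
        have := hcl0 y hyy x hxy.symm
        tauto
      · rintro ⟨h1, h2⟩
        have hxx : x ∈ D0 := by tauto
        have := hcl0 x hxx y hxy
        tauto
  obtain ⟨hDne, hzD, hvD, hwD, hclD, e, he, hez, hev, hew⟩ := hD
  obtain ⟨d, hd, hvd⟩ : ∃ d ∈ D, G.Adj v d := by
    by_contra h
    push Not at h
    have := hK D z w hDne hzD hwD (by
      intro u hu t hut
      rcases hclD u hu t hut with h' | h' | h' | h'
      · exact Or.inl h'
      · exact Or.inr (Or.inl h')
      · subst h'; exact absurd hut.symm (h u hu)
      · exact Or.inr (Or.inr h')) e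
    tauto
  have hdC : d ∈ C := by
    rcases hcl v hv d hvd with h | h | h | h
    · exact h
    all_goals (subst h; contradiction)
  refine ⟨z, v, w, D ∩ C, hzv, ⟨⟨d, hd, hdC⟩, fun h => hzD h.1, fun h => hvD h.1,
    fun h => hwD h.1, ?_, e, fun h => he h.1, hez, hev, hew⟩, ?_⟩
  · rintro u ⟨hu1, hu2⟩ t hut
    have h1 := hclD u hu1 t hut
    have h2 := hcl u hu2 t hut
    rcases h1 with h1 | h1
    · left
      refine ⟨h1, ?_⟩
      rcases h2 with h | h | h | h
      · exact h
      all_goals (subst h; contradiction)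
    · exact Or.inr h1
  · exact ⟨Set.inter_subset_right, fun h => hvD (h hv).1⟩

theorem no_frag {V : Type*} [Fintype V] (G : SimpleGraph V) (hK : Cut3 G)
    (hall : ∀ x y, G.Adj x y → ∃ z C, Frag G x y z C) :
    ∀ (n : ℕ) (x y z : V) (C : Set V), C.ncard = n → G.Adj x y → ¬ Frag G x y z C := by
  intro n
  induction n using Nat.strong_induction_on with
  | _ n ih =>
    intro x y z C hn hxy hF
    obtain ⟨x', y', z', C', h1, h2, h3⟩ := frag_step G hK hall x y z C hxy hF
    exact ih _ (hn ▸ Set.ncard_lt_ncard h3 (Set.toFinite _)) x' y' z' C' rfl h1 h2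

theorem exists_edge {V : Type*} [Fintype V] [DecidableEq V] (G : SimpleGraph V) (hK : Cut3 G)
    (h : 2 < Fintype.card V) : ∃ x y, G.Adj x y := by
  obtain ⟨a, b, c, hab, hac, hbc⟩ := Fintype.two_lt_card_iff.1 h
  by_contra hn
  push Not at hn
  have := hK {a} b b ⟨a, rfl⟩ (fun h => hab h.symm) (fun h => hab h.symm)
    (fun u _ w h => absurd h (hn u w)) c
  simp at this
  grind

theorem main_minor (n : ℕ) : ∀ {V : Type*} [Fintype V] [DecidableEq V] (G : SimpleGraph V),
    Cut3 G → Fintype.card V = n + 5 → HasW4Minor G := by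
  induction n with
  | zero => intro V _ _ G hK hc; exact base5 G hK hc
  | succ n ih =>
    intro V _ _ G hK hc
    obtain ⟨x, y, hxy, hK'⟩ : ∃ x y, ∃ h : G.Adj x y, Cut3 (quot G (cmap x y h.ne)) := by
      by_contra hn
      push Not at hn
      have hall : ∀ x y, G.Adj x y → ∃ z C, Frag G x y z C :=
        fun x y h => frag_of G hK x y h.ne (hn x y h)
      obtain ⟨x, y, hxy⟩ := exists_edge G hK (by omega)
      obtain ⟨z, C, hF⟩ := hall x y hxy
      exact no_frag G hK hall _ x y z C rfl hxy hF
    refine minor_of_quot G (cmap x y hxy.ne) ?_ ?_ (ih _ hK' ?_)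
    · intro w
      exact ⟨w.1, by rw [cmap_eq]; simp⟩
    · intro u v huv
      unfold cmap at huv
      have := hxy.symm
      split_ifs at huv <;> rw [Subtype.ext_iff] at huv <;> simp at huv <;> grind
    · rw [Fintype.card_subtype_compl, hc]
      simp

/-- The only 3-connected graph with no `W_4` minor is `K_4`. -/
theorem three_connected_no_W4_minor_iso_K4
    {V : Type*} [Fintype V] [DecidableEq V] (G : SimpleGraph V)
    (h3 : IsThreeConnected G) (hW4 : ¬ HasW4Minor G) :
    Nonempty (G ≃g (⊤ : SimpleGraph (Fin 4))) := by
  have hK := cut3_of G h3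
  have h4 : Fintype.card V = 4 := by
    by_contra hne
    have h := h3.1
    exact hW4 (main_minor (Fintype.card V - 5) G hK (by omega))
  have hadj : ∀ v a, v ≠ a → G.Adj v a := by
    intro v a hva
    by_contra hn
    have hc : (({v, a} : Finset V)ᶜ).card = 2 := by
      rw [Finset.card_compl, h4, Finset.card_pair hva]
    obtain ⟨c, d, hcd, he⟩ := Finset.card_eq_two.1 hc
    have hm : ∀ w, w ∈ (({v, a} : Finset V)ᶜ) ↔ w ∈ ({c, d} : Finset V) := by
      intro w; rw [he]
    simp at hm
    have hmc := hm c
    have hmd := hm d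
    have hma := hm a
    simp at hmc hmd hma
    have := hK {v} c d ⟨v, rfl⟩ (fun h => hmc.1 h) (fun h => hmd.1 h) (by
      intro u hu w huw
      have : u = v := hu
      subst this
      have := huw.ne
      have := hm w
      grind) a
    simp at this
    grind
  refine ⟨⟨Fintype.equivFinOfCardEq h4, ?_⟩⟩
  intro a b
  simp only [SimpleGraph.top_adj, ne_eq, EmbeddingLike.apply_eq_iff_eq]
  exact ⟨hadj a b, fun h => h.ne⟩
end
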